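/- There exists a domain U in ℝ³ with smooth boundary that is not convex but is uniquely determined in the class of all three-dimensional domains with smooth boundaries by the condition of local isometry of boundaries in the relative metrics: for every domain V ⊆ ℝ³ with smooth boundary, if there exists a bijective local isometry f: ∂U → ∂V in the relative metrics of the boundaries, then there exists a Euclidean isometry J: ℝ³ → ℝ³ with J(U) = V. -/

import Mathlib

open Set Filter Metric Topology ENNReal

noncomputable section

/-- A domain in `ℝⁿ`: a nonempty open connected set. -/
def IsDomainSet {n : ℕ} (U : Set (EuclideanSpace ℝ (Fin n))) : Prop :=
  IsOpen U ∧ IsConnected U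

/-- The infimum of lengths of smooth paths joining `a` and `b` inside `U`. -/
def smoothPathInf {n : ℕ} (U : Set (EuclideanSpace ℝ (Fin n)))
    (a b : EuclideanSpace ℝ (Fin n)) : ℝ≥0∞ :=
  ⨅ (γ : ℝ → EuclideanSpace ℝ (Fin n)) (_ : ContDiff ℝ 1 γ) (_ : γ 0 = a)
    (_ : γ 1 = b) (_ : ∀ t ∈ Icc (0:ℝ) 1, γ t ∈ U), eVariationOn γ (Icc 0 1)

/-- The relative metric `ρ_{∂U,U}`:
`ρ(x,y) = liminf_{x'→x, y'→y; x',y'∈U} inf{length γ : γ smooth path joining x',y' in U}`. -/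
def relDist {n : ℕ} (U : Set (EuclideanSpace ℝ (Fin n)))
    (x y : EuclideanSpace ℝ (Fin n)) : ℝ≥0∞ :=
  Filter.liminf (fun p : EuclideanSpace ℝ (Fin n) × EuclideanSpace ℝ (Fin n) =>
    smoothPathInf U p.1 p.2) ((𝓝[U] x) ×ˢ (𝓝[U] y))

/-- `f` is a bijection of `∂U` onto `∂V` which is a local isometry
in the relative metrics of the boundaries. -/
def IsBoundaryLocalIsometry {n : ℕ} (U V : Set (EuclideanSpace ℝ (Fin n)))
    (f : EuclideanSpace ℝ (Fin n) → EuclideanSpace ℝ (Fin n)) : Prop :=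
  Set.BijOn f (frontier U) (frontier V) ∧
  ∀ y ∈ frontier U, ∃ ε : ℝ≥0∞, 0 < ε ∧ ∀ a ∈ frontier U, ∀ b ∈ frontier U,
    relDist U a y < ε → relDist U b y < ε →
      relDist U a b = relDist V (f a) (f b)

/-- `U` has smooth boundary: `∂U` is an `(n-1)`-dimensional submanifold of
class `C¹` without boundary, i.e. near each of its points the frontier can be
mapped by a `C¹` diffeomorphism onto an open piece of a hyperplane. -/
def HasC1Boundary {n : ℕ} (U : Set (EuclideanSpace ℝ (Fin n))) : Prop :=
  ∀ x ∈ frontier U, ∃ (W W' : Set (EuclideanSpace ℝ (Fin n)))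
    (φ ψ : EuclideanSpace ℝ (Fin n) → EuclideanSpace ℝ (Fin n))
    (ℓ : EuclideanSpace ℝ (Fin n) →L[ℝ] ℝ),
    IsOpen W ∧ x ∈ W ∧ IsOpen W' ∧ ℓ ≠ 0 ∧
    ContDiffOn ℝ 1 φ W ∧ ContDiffOn ℝ 1 ψ W' ∧
    Set.MapsTo φ W W' ∧ Set.MapsTo ψ W' W ∧
    (∀ z ∈ W, ψ (φ z) = z) ∧ (∀ z ∈ W', φ (ψ z) = z) ∧
    φ '' (W ∩ frontier U) = W' ∩ {y | ℓ y = 0}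

/-- The intrinsic distance inside a set `S`: the infimum of lengths of
(continuous) paths joining `a` and `b` inside `S`. -/
def intrinsicDist {n : ℕ} (S : Set (EuclideanSpace ℝ (Fin n)))
    (a b : EuclideanSpace ℝ (Fin n)) : ℝ≥0∞ :=
  ⨅ (γ : ℝ → EuclideanSpace ℝ (Fin n)) (_ : ContinuousOn γ (Icc (0:ℝ) 1))
    (_ : γ 0 = a) (_ : γ 1 = b) (_ : ∀ t ∈ Icc (0:ℝ) 1, γ t ∈ S),
    eVariationOn γ (Icc 0 1)

/-- A homotopy of nonvanishing complex functions transports continuous logarithms. -/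
theorem exists_continuous_log_of_homotopy {X : Type*} [TopologicalSpace X]
    {H : ℝ × X → ℂ} (hH : Continuous H) (hne : ∀ t ∈ Icc (0:ℝ) 1, ∀ x, H (t, x) ≠ 0)
    (h0 : ∃ L : X → ℂ, Continuous L ∧ ∀ x, Complex.exp (L x) = H (0, x)) :
    ∃ L : X → ℂ, Continuous L ∧ ∀ x, Complex.exp (L x) = H (1, x) := by
  obtain ⟨L, hL, hLe⟩ := h0
  let K : C(unitInterval × X, {z : ℂ // z ≠ 0}) :=
    ⟨fun p => ⟨H (p.1, p.2), hne _ p.1.2 _⟩, by fun_prop⟩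
  have hK : ∀ x, K (0, x) = (⟨_, (L x).exp_ne_zero⟩ : {z : ℂ // z ≠ 0}) := fun x =>
    Subtype.ext (hLe x).symm
  let M := Complex.isCoveringMap_exp.liftHomotopy K ⟨L, hL⟩ hK
  refine ⟨fun x => M (1, x), by fun_prop, fun x => ?_⟩
  have h1 := congrFun (Complex.isCoveringMap_exp.liftHomotopy_lifts K ⟨L, hL⟩ hK) (1, x)
  exact congrArg Subtype.val h1

/-- An odd nonvanishing function on a connected space with continuous fixed-point free
involution has no continuous logarithm. -/
theorem not_exists_continuous_log_of_odd {X : Type*} [TopologicalSpace X] [PreconnectedSpace X]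
    [Nonempty X] {g : X → ℂ} {σ : X → X} (hσ : Continuous σ) (hσσ : ∀ x, σ (σ x) = x)
    (hg : ∀ x, g (σ x) = - g x) (hlog : ∃ L : X → ℂ, Continuous L ∧ ∀ x, Complex.exp (L x) = g x) :
    False := by
  obtain ⟨L, hL, hLe⟩ := hlog
  have h1 : ∀ x, ∃ n : ℤ, L (σ x) - L x = Real.pi * Complex.I + n * (2 * Real.pi * Complex.I) := by
    intro x
    have : Complex.exp (L (σ x)) = Complex.exp (L x + Real.pi * Complex.I) := by
      rw [Complex.exp_add, Complex.exp_pi_mul_I, hLe, hLe, hg]; ring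
    obtain ⟨n, hn⟩ := Complex.exp_eq_exp_iff_exists_int.1 this
    exact ⟨n, by rw [hn]; ring⟩
  choose n hn using h1
  have hloc : IsLocallyConstant n := by
    rw [IsLocallyConstant.iff_continuous]
    have hc : Continuous fun x => ((n x : ℤ) : ℝ) := by
      have : (fun x => ((n x : ℤ) : ℝ)) = fun x => ((L (σ x) - L x).im - Real.pi) / (2 * Real.pi) := by
        funext x
        rw [hn]
        have := Real.pi_ne_zero
        simp
      rw [this]
      fun_prop
    exact Int.isClosedEmbedding_coe_real.isInducing.continuous_iff.2 hc
  obtain ⟨x⟩ := ‹Nonempty X›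
  have e : n (σ x) = n x := hloc.apply_eq_of_preconnectedSpace _ _
  have e1 := hn x
  have e2 := hn (σ x)
  rw [hσσ, e] at e2
  have e3 := congrArg Complex.im (congrArg₂ (· + ·) e1 e2)
  simp at e3
  have hpi := Real.pi_ne_zero
  have : ((1 + 2 * n x : ℤ) : ℝ) = 0 := by
    push_cast
    have : Real.pi * (1 + 2 * (n x : ℝ)) = 0 := by linarith
    simpa [hpi] using this
  have : (1 + 2 * n x : ℤ) = 0 := by exact_mod_cast this
  omega

/-- Planar invariance of domain at the centre of a disc. -/
theorem image_closedBall_mem_nhds_of_injOn {g : ℂ → ℂ} (hg : Continuous g)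
    (hinj : InjOn g (closedBall 0 1)) : g '' closedBall 0 1 ∈ 𝓝 (g 0) := by
  obtain ⟨δ, hδ, hmin⟩ : ∃ δ > 0, ∀ z ∈ sphere (0:ℂ) 1, δ ≤ ‖g z - g 0‖ := by
    obtain ⟨z, hz, hzm⟩ := (isCompact_sphere (0:ℂ) 1).exists_isMinOn
      (NormedSpace.sphere_nonempty.2 zero_le_one) (f := fun z => ‖g z - g 0‖) (by fun_prop)
    refine ⟨_, ?_, fun w hw => hzm hw⟩
    refine norm_pos_iff.2 (sub_ne_zero.2 fun h => ?_)
    have := hinj (sphere_subset_closedBall hz) (by simp) h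
    simp [this] at hz
  refine mem_of_superset (ball_mem_nhds _ hδ) fun w hw => ?_
  by_contra hwn
  have hne : ∀ z ∈ closedBall (0:ℂ) 1, g z - w ≠ 0 := fun z hz h =>
    hwn ⟨z, hz, sub_eq_zero.1 h⟩
  have hS : ∀ x : sphere (0:ℂ) 1, ‖(x:ℂ)‖ = 1 := fun x => by simp
  -- contract the disc
  have l1 : ∃ L : sphere (0:ℂ) 1 → ℂ, Continuous L ∧ ∀ x, Complex.exp (L x) = g x - w := by
    have := exists_continuous_log_of_homotopy (X := sphere (0:ℂ) 1)
      (H := fun p => g (p.1 * p.2) - w) (by fun_prop)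
      (by
        intro t ht x
        refine hne _ ?_
        simp only [mem_closedBall_zero_iff, norm_mul, hS, mul_one, Complex.norm_real]
        rw [Real.norm_of_nonneg ht.1]; exact ht.2)
      ⟨fun _ => Complex.log (g 0 - w), continuous_const, fun x => by
        simpa using Complex.exp_log (hne 0 (by simp))⟩
    simpa using this
  -- move `w` to `g 0`
  have l2 : ∃ L : sphere (0:ℂ) 1 → ℂ, Continuous L ∧ ∀ x, Complex.exp (L x) = g x - g 0 := by
    have := exists_continuous_log_of_homotopy (X := sphere (0:ℂ) 1)
      (H := fun p => g p.2 - g 0 + (1 - p.1) * (g 0 - w)) (by fun_prop)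
      (by
        intro t ht x h
        have h1 : g x - g 0 = - ((1 - t) * (g 0 - w)) := eq_neg_of_add_eq_zero_left h
        have h2 := hmin x x.2
        rw [h1, norm_neg, norm_mul, ← Complex.ofReal_one, ← Complex.ofReal_sub, Complex.norm_real,
          Real.norm_of_nonneg (by linarith [ht.2])] at h2
        rw [mem_ball, dist_comm, dist_eq_norm] at hw
        nlinarith [ht.1, norm_nonneg (g 0 - w)])
      (by simpa using l1)
    simpa using this
  -- make the map odd
  have l3 : ∃ L : sphere (0:ℂ) 1 → ℂ, Continuous L ∧
      ∀ x, Complex.exp (L x) = g (2⁻¹ * x) - g (-(2⁻¹ * x)) := by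
    have := exists_continuous_log_of_homotopy (X := sphere (0:ℂ) 1)
      (H := fun p => g (((1 - p.1 / 2 : ℝ) : ℂ) * p.2) - g (-(((p.1 / 2 : ℝ) : ℂ) * p.2)))
      (by fun_prop)
      (by
        intro t ht x h
        have := hinj ?_ ?_ (sub_eq_zero.1 h)
        · have h3 : (x:ℂ) = 0 := by
            push_cast at this
            linear_combination this
          have := hS x
          simp [h3] at this
        · simp only [mem_closedBall_zero_iff, norm_mul, hS, mul_one, Complex.norm_real]
          rw [Real.norm_of_nonneg] <;> linarith [ht.1, ht.2]
        · simp only [mem_closedBall_zero_iff, norm_mul, hS, mul_one, Complex.norm_real, norm_neg]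
          rw [Real.norm_of_nonneg] <;> linarith [ht.1, ht.2])
      (by simpa using l2)
    obtain ⟨L, hL, hLe⟩ := this
    refine ⟨L, hL, fun x => ?_⟩
    rw [hLe]; norm_num
  have : PreconnectedSpace (sphere (0:ℂ) 1) :=
    Subtype.preconnectedSpace (isPreconnected_sphere (by simp) 0 1)
  have : Nonempty (sphere (0:ℂ) 1) := ⟨1, by simp⟩
  exact not_exists_continuous_log_of_odd (σ := fun x : sphere (0:ℂ) 1 => -x)
    continuous_neg (by simp) (by intro x; simp) l3

/-- Planar invariance of domain: a continuous injective map of a closed disc is open at the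
centre. -/
theorem image_closedBall_mem_nhds {g : ℂ → ℂ} {c : ℂ} {r : ℝ} (hr : 0 < r)
    (hg : ContinuousOn g (closedBall c r)) (hinj : InjOn g (closedBall c r)) :
    g '' closedBall c r ∈ 𝓝 (g c) := by
  obtain ⟨G, hG⟩ := ContinuousMap.exists_restrict_eq (isClosed_closedBall (x := c) (ε := r))
    ⟨_, hg.domRestrict⟩
  have hGg : ∀ z ∈ closedBall c r, G z = g z := fun z hz => congrArg (fun k => k ⟨z, hz⟩) hG
  have hm : ∀ z ∈ closedBall (0:ℂ) 1, c + r * z ∈ closedBall c r := by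
    intro z hz
    rw [mem_closedBall_zero_iff] at hz
    rw [mem_closedBall, dist_eq_norm, add_sub_cancel_left, norm_mul, Complex.norm_real,
      Real.norm_of_nonneg hr.le]
    nlinarith
  have hr' : (r:ℂ) ≠ 0 := by exact_mod_cast hr.ne'
  have := image_closedBall_mem_nhds_of_injOn (g := fun z => G (c + r * z)) (by fun_prop) (by
    intro z hz w hw h
    simp only [hGg _ (hm z hz), hGg _ (hm w hw)] at h
    exact mul_left_cancel₀ hr' (add_left_cancel (hinj (hm z hz) (hm w hw) h)))
  simp only [mul_zero, add_zero, hGg c (mem_closedBall_self hr.le)] at this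
  refine mem_of_superset this ?_
  rintro _ ⟨z, hz, rfl⟩
  exact ⟨_, hm z hz, (hGg _ (hm z hz)).symm⟩

section Paths

variable {n : ℕ} {U : Set (EuclideanSpace ℝ (Fin n))} {a b c : EuclideanSpace ℝ (Fin n)}

theorem smoothPathInf_le {γ : ℝ → EuclideanSpace ℝ (Fin n)} (hγ : ContDiff ℝ 1 γ)
    (h0 : γ 0 = a) (h1 : γ 1 = b) (hU : ∀ t ∈ Icc (0:ℝ) 1, γ t ∈ U) :
    smoothPathInf U a b ≤ eVariationOn γ (Icc 0 1) :=
  iInf_le_of_le γ <| iInf_le_of_le hγ <| iInf_le_of_le h0 <| iInf_le_of_le h1 <| iInf_le _ hU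

theorem exists_path_of_smoothPathInf_lt {r : ℝ≥0∞} (h : smoothPathInf U a b < r) :
    ∃ γ : ℝ → EuclideanSpace ℝ (Fin n), ContDiff ℝ 1 γ ∧ γ 0 = a ∧ γ 1 = b ∧
      (∀ t ∈ Icc (0:ℝ) 1, γ t ∈ U) ∧ eVariationOn γ (Icc 0 1) < r := by
  simp only [smoothPathInf, iInf_lt_iff] at h
  obtain ⟨γ, h1, h2, h3, h4, h5⟩ := h
  exact ⟨γ, h1, h2, h3, h4, h5⟩

theorem edist_le_smoothPathInf : edist a b ≤ smoothPathInf U a b := by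
  refine le_of_forall_gt fun r hr => ?_
  obtain ⟨γ, -, rfl, rfl, -, h⟩ := exists_path_of_smoothPathInf_lt hr
  exact (eVariationOn.edist_le γ (by simp) (by simp)).trans_lt h

theorem eVariationOn_Icc_le_of_dist_le {E : Type*} [PseudoMetricSpace E] {γ : ℝ → E}
    {K s t : ℝ} (hK : 0 ≤ K) (hst : s ≤ t)
    (h : ∀ u ∈ Icc s t, ∀ v ∈ Icc s t, dist (γ u) (γ v) ≤ K * |u - v|) :
    eVariationOn γ (Icc s t) ≤ ENNReal.ofReal (K * (t - s)) := by
  have hl : LipschitzOnWith K.toNNReal γ (Icc s t) :=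
    LipschitzOnWith.of_dist_le_mul fun u hu v hv => by
      rw [Real.coe_toNNReal _ hK, Real.dist_eq]; exact h u hu v hv
  have h1 := hl.comp_eVariationOn_le (g := id) (s := Icc s t) (fun _ h => h)
  have h2 := (monotone_id.monotoneOn (Icc s t)).eVariationOn_eq (left_mem_Icc.2 hst)
    (right_mem_Icc.2 hst)
  rw [inter_self] at h2
  rw [Function.comp_id] at h1
  rw [ENNReal.ofReal_mul hK]
  exact h1.trans (mul_le_mul_right h2.le _)

theorem smoothPathInf_le_of_segment_subset (h : segment ℝ a b ⊆ U) :
    smoothPathInf U a b ≤ edist a b := by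
  have hl : ContDiff ℝ 1 fun t : ℝ => AffineMap.lineMap a b t := by
    simp only [AffineMap.lineMap_apply_module]
    fun_prop
  refine (smoothPathInf_le hl (by simp) (by simp) fun t ht => h ?_).trans ?_
  · rw [segment_eq_image_lineMap]; exact ⟨t, ht, rfl⟩
  · refine (eVariationOn_Icc_le_of_dist_le (K := dist a b) dist_nonneg zero_le_one
      fun u _ v _ => ?_).trans ?_
    · rw [dist_lineMap_lineMap, Real.dist_eq, mul_comm]
    · simp [edist_dist]

theorem smoothPathInf_subpath_le {γ : ℝ → EuclideanSpace ℝ (Fin n)} (hγ : ContDiff ℝ 1 γ)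
    {s t : ℝ} (hst : s ≤ t) (hU : ∀ u ∈ Icc s t, γ u ∈ U) :
    smoothPathInf U (γ s) (γ t) ≤ eVariationOn γ (Icc s t) := by
  have hm : MapsTo (fun u : ℝ => s + u * (t - s)) (Icc 0 1) (Icc s t) := by
    rintro u ⟨h0, h1⟩
    constructor <;> nlinarith
  refine (smoothPathInf_le (γ := γ ∘ fun u => s + u * (t - s)) (hγ.comp (by fun_prop))
    (by simp) (by simp) fun u hu => hU _ (hm hu)).trans ?_
  refine eVariationOn.comp_le_of_monotoneOn _ _ (fun u _ v _ huv => ?_) hm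
  have : 0 ≤ t - s := sub_nonneg.2 hst
  show s + u * (t - s) ≤ s + v * (t - s)
  gcongr

theorem smoothPathInf_triangle :
    smoothPathInf U a c ≤ smoothPathInf U a b + smoothPathInf U b c := by
  refine ENNReal.le_of_forall_pos_le_add fun ε hε hlt => ?_
  have hε' : (0 : ℝ≥0∞) < ε / 2 := by simpa using hε.ne'
  obtain ⟨γ, hγ, rfl, rfl, hγU, hγl⟩ := exists_path_of_smoothPathInf_lt
    (ENNReal.lt_add_right (ENNReal.add_lt_top.1 hlt).1.ne hε'.ne')
  obtain ⟨η, hη, hηb, rfl, hηU, hηl⟩ := exists_path_of_smoothPathInf_lt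
    (ENNReal.lt_add_right (ENNReal.add_lt_top.1 hlt).2.ne hε'.ne')
  set σ := Real.smoothTransition
  have hσ : ContDiff ℝ 1 σ := Real.smoothTransition.contDiff (n := 1)
  have hσI : ∀ t, σ t ∈ Icc (0:ℝ) 1 := fun t =>
    ⟨Real.smoothTransition.nonneg t, Real.smoothTransition.le_one t⟩
  let κ : ℝ → EuclideanSpace ℝ (Fin n) := fun t => γ (σ (2 * t)) + η (σ (2 * t - 1)) - γ 1
  have hκ1 : ∀ t ≤ (1/2 : ℝ), κ t = γ (σ (2 * t)) := fun t ht => by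
    have : σ (2 * t - 1) = 0 := Real.smoothTransition.zero_of_nonpos (by linarith)
    simp [κ, this, hηb]
  have hκ2 : ∀ t, (1/2 : ℝ) ≤ t → κ t = η (σ (2 * t - 1)) := fun t ht => by
    have : σ (2 * t) = 1 := Real.smoothTransition.one_of_one_le (by linarith)
    simp [κ, this]
  have hκ : ContDiff ℝ 1 κ := by
    have h1 : ContDiff ℝ 1 fun t : ℝ => γ (σ (2 * t)) := hγ.comp (hσ.comp (by fun_prop))
    have h2 : ContDiff ℝ 1 fun t : ℝ => η (σ (2 * t - 1)) := hη.comp (hσ.comp (by fun_prop))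
    exact (h1.add h2).sub contDiff_const
  have e0 : κ 0 = γ 0 := by
    rw [hκ1 0 (by norm_num), mul_zero]; exact congrArg γ Real.smoothTransition.zero
  have e1 : κ 1 = η 1 := by
    rw [hκ2 1 (by norm_num)]; norm_num; exact congrArg η Real.smoothTransition.one
  refine (smoothPathInf_le hκ e0 e1 fun t _ => ?_).trans ?_
  · rcases le_total t (1/2) with h | h
    · rw [hκ1 t h]; exact hγU _ (hσI _)
    · rw [hκ2 t h]; exact hηU _ (hσI _)
  · have hadd := eVariationOn.Icc_add_Icc κ (s := univ) (a := 0) (b := 1/2) (c := 1)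
      (by norm_num) (by norm_num) (mem_univ _)
    simp only [univ_inter] at hadd
    rw [← hadd]
    have v1 : eVariationOn κ (Icc 0 (1/2)) ≤ eVariationOn γ (Icc 0 1) := by
      rw [eVariationOn.congr (g := γ ∘ fun t => σ (2 * t)) fun t ht => hκ1 t ht.2]
      refine eVariationOn.comp_le_of_monotoneOn _ _ (fun u _ v _ huv => ?_) fun t _ => hσI _
      exact Real.smoothTransition.monotone (by linarith)
    have v2 : eVariationOn κ (Icc (1/2) 1) ≤ eVariationOn η (Icc 0 1) := by
      rw [eVariationOn.congr (g := η ∘ fun t => σ (2 * t - 1)) fun t ht => hκ2 t ht.1]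
      refine eVariationOn.comp_le_of_monotoneOn _ _ (fun u _ v _ huv => ?_) fun t _ => hσI _
      exact Real.smoothTransition.monotone (by linarith)
    refine (add_le_add (v1.trans hγl.le) (v2.trans hηl.le)).trans (le_of_eq ?_)
    rw [add_add_add_comm, ENNReal.add_halves]

theorem edist_le_relDist : edist a b ≤ relDist U a b := by
  refine le_of_forall_lt fun r hr => ?_
  obtain ⟨r', hr, hr'⟩ := exists_between hr
  refine hr.trans_le (le_liminf_of_le (h := ?_))
  have : Tendsto (fun p : EuclideanSpace ℝ (Fin n) × EuclideanSpace ℝ (Fin n) => edist p.1 p.2)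
      (𝓝[U] a ×ˢ 𝓝[U] b) (𝓝 (edist a b)) :=
    (tendsto_nhdsWithin_of_tendsto_nhds tendsto_id |>.comp tendsto_fst).edist
      (tendsto_nhdsWithin_of_tendsto_nhds tendsto_id |>.comp tendsto_snd)
  filter_upwards [this.eventually_const_lt hr'] with p hp
  exact hp.le.trans edist_le_smoothPathInf

theorem relDist_le_of_tendsto {ι : Type*} {l : Filter ι} [l.NeBot]
    {u v : ι → EuclideanSpace ℝ (Fin n)} {C : ι → ℝ≥0∞} {C' : ℝ≥0∞}
    (hu : Tendsto u l (𝓝 a)) (hv : Tendsto v l (𝓝 b)) (huU : ∀ᶠ i in l, u i ∈ U)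
    (hvU : ∀ᶠ i in l, v i ∈ U) (h : ∀ᶠ i in l, smoothPathInf U (u i) (v i) ≤ C i)
    (hC : Tendsto C l (𝓝 C')) : relDist U a b ≤ C' := by
  have ht : Tendsto (fun i => (u i, v i)) l (𝓝[U] a ×ˢ 𝓝[U] b) :=
    (tendsto_nhdsWithin_iff.2 ⟨hu, huU⟩).prodMk (tendsto_nhdsWithin_iff.2 ⟨hv, hvU⟩)
  calc relDist U a b ≤ liminf (fun i => smoothPathInf U (u i) (v i)) l := by
        exact liminf_le_liminf_of_le ht
    _ ≤ liminf C l := liminf_le_liminf h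
    _ = C' := hC.liminf_eq

theorem exists_seq_of_relDist_eq {L : ℝ} (h : relDist U a b = ENNReal.ofReal L) (hL : 0 ≤ L) :
    ∃ u v : ℕ → EuclideanSpace ℝ (Fin n), Tendsto u atTop (𝓝 a) ∧ Tendsto v atTop (𝓝 b) ∧
      (∀ k, u k ∈ U) ∧ (∀ k, v k ∈ U) ∧
      (∀ k, smoothPathInf U (u k) (v k) < ENNReal.ofReal (L + 1 / (k + 1))) := by
  have key : ∀ k : ℕ, ∃ p : EuclideanSpace ℝ (Fin n) × EuclideanSpace ℝ (Fin n),
      smoothPathInf U p.1 p.2 < ENNReal.ofReal (L + 1 / (k + 1)) ∧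
      dist p.1 a < 1 / (k + 1) ∧ dist p.2 b < 1 / (k + 1) := by
    intro k
    have hk : (0:ℝ) < 1 / (k + 1) := Nat.one_div_pos_of_nat
    have hlt : relDist U a b < ENNReal.ofReal (L + 1 / (k + 1)) := by
      rw [h]; exact (ENNReal.ofReal_lt_ofReal_iff (by linarith)).2 (by linarith)
    have h1 := frequently_lt_of_liminf_lt (h := hlt)
    have h2 : ∀ᶠ p in 𝓝[U] a ×ˢ 𝓝[U] b, dist p.1 a < 1 / ((k:ℝ) + 1) ∧ dist p.2 b < 1 / ((k:ℝ) + 1) :=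
      Filter.Eventually.prod_mk (mem_nhdsWithin_of_mem_nhds (ball_mem_nhds a hk))
        (mem_nhdsWithin_of_mem_nhds (ball_mem_nhds b hk))
    exact (h1.and_eventually h2).exists
  choose p hp hpa hpb using key
  refine ⟨fun k => (p k).1, fun k => (p k).2, ?_, ?_,
    fun k => ?_, fun k => ?_, hp⟩
  · exact squeeze_zero (fun _ => dist_nonneg) (fun k => (hpa k).le)
      tendsto_one_div_add_atTop_nhds_zero_nat |> tendsto_iff_dist_tendsto_zero.2
  · exact squeeze_zero (fun _ => dist_nonneg) (fun k => (hpb k).le)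
      tendsto_one_div_add_atTop_nhds_zero_nat |> tendsto_iff_dist_tendsto_zero.2
  · obtain ⟨γ, -, h0, -, hU, -⟩ := exists_path_of_smoothPathInf_lt (hp k)
    show (p k).1 ∈ U
    rw [← h0]
    exact hU 0 (by simp)
  · obtain ⟨γ, -, -, h1, hU, -⟩ := exists_path_of_smoothPathInf_lt (hp k)
    show (p k).2 ∈ U
    rw [← h1]
    exact hU 1 (by simp)

/-- A path of length less than `ℓ` can be sampled proportionally to arc length. -/
theorem exists_arclength_sampling {ℓ : ℝ} (h : smoothPathInf U a b < ENNReal.ofReal ℓ) :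
    ∃ κ : ℝ → EuclideanSpace ℝ (Fin n), ∀ t ∈ Icc (0:ℝ) 1, κ t ∈ U ∧
      smoothPathInf U a (κ t) ≤ ENNReal.ofReal (t * ℓ) ∧
      smoothPathInf U (κ t) b ≤ ENNReal.ofReal ((1 - t) * ℓ) ∧
      ∀ s ∈ Icc (0:ℝ) 1, dist (κ s) (κ t) ≤ |s - t| * ℓ := by
  obtain ⟨γ, hγ, rfl, rfl, hγU, hγl⟩ := exists_path_of_smoothPathInf_lt h
  have hℓ : 0 < ℓ := by
    by_contra hn
    simp [ENNReal.ofReal_of_nonpos (not_lt.1 hn)] at h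
  obtain ⟨K, hK⟩ := hγ.contDiffOn.exists_lipschitzOnWith (s := Icc (0:ℝ) 1) one_ne_zero
    (convex_Icc _ _) isCompact_Icc
  have hsub : ∀ {s t : ℝ}, s ∈ Icc (0:ℝ) 1 → t ∈ Icc (0:ℝ) 1 → Icc s t ⊆ Icc 0 1 :=
    fun hs ht => Icc_subset_Icc hs.1 ht.2
  have hfin : ∀ {s t : ℝ}, s ∈ Icc (0:ℝ) 1 → t ∈ Icc (0:ℝ) 1 →
      eVariationOn γ (Icc s t) ≠ ⊤ := fun hs ht =>
    ((eVariationOn.mono γ (hsub hs ht)).trans_lt hγl).ne_top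
  have h0 : (0:ℝ) ∈ Icc (0:ℝ) 1 := by simp
  have h1 : (1:ℝ) ∈ Icc (0:ℝ) 1 := by simp
  let v : ℝ → ℝ := fun t => (eVariationOn γ (Icc 0 t)).toReal
  have hv : ∀ {s t : ℝ}, s ∈ Icc (0:ℝ) 1 → t ∈ Icc (0:ℝ) 1 → s ≤ t →
      eVariationOn γ (Icc s t) = ENNReal.ofReal (v t - v s) := by
    intro s t hs ht hst
    have := eVariationOn.Icc_add_Icc γ (s := univ) hs.1 hst (mem_univ _)
    simp only [univ_inter] at this
    have h3 : v t = v s + (eVariationOn γ (Icc s t)).toReal := by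
      simp only [v]
      rw [← this, ENNReal.toReal_add (hfin h0 hs) (hfin hs ht)]
    rw [h3, add_sub_cancel_left, ENNReal.ofReal_toReal (hfin hs ht)]
  have hvl : ∀ {s t : ℝ}, s ∈ Icc (0:ℝ) 1 → t ∈ Icc (0:ℝ) 1 → s ≤ t →
      |v t - v s| ≤ K * (t - s) ∧ dist (γ s) (γ t) ≤ |v t - v s| := by
    intro s t hs ht hst
    have e1 := eVariationOn_Icc_le_of_dist_le (γ := γ) K.2 hst fun x hx y hy => by
      rw [← Real.dist_eq]
      exact hK.dist_le_mul x (hsub hs ht hx) y (hsub hs ht hy)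
    have e2 := eVariationOn.edist_le γ (left_mem_Icc.2 hst) (right_mem_Icc.2 hst)
    have e3 : 0 ≤ v t - v s := sub_nonneg.2 <| ENNReal.toReal_mono (hfin h0 ht)
      (eVariationOn.mono γ (Icc_subset_Icc_right hst))
    rw [hv hs ht hst] at e1 e2
    rw [abs_of_nonneg e3]
    constructor
    · exact (ENNReal.ofReal_le_ofReal_iff (mul_nonneg K.2 (sub_nonneg.2 hst))).1 e1
    · rw [edist_dist] at e2
      exact (ENNReal.ofReal_le_ofReal_iff e3).1 e2
  have hvc : ContinuousOn v (Icc 0 1) := by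
    refine LipschitzOnWith.continuousOn (K := K) (LipschitzOnWith.of_dist_le_mul ?_)
    intro s hs t ht
    rcases le_total s t with hst | hst
    · rw [Real.dist_eq, Real.dist_eq, abs_sub_comm, abs_sub_comm s t,
        abs_of_nonneg (sub_nonneg.2 hst)]
      exact (hvl hs ht hst).1
    · rw [Real.dist_eq, Real.dist_eq, abs_of_nonneg (sub_nonneg.2 hst)]
      exact (hvl ht hs hst).1
  have hv0 : v 0 = 0 := by simp [v, eVariationOn.subsingleton]
  have hv1 : v 1 < ℓ := by
    have := (ENNReal.toReal_lt_toReal (hfin h0 h1) ENNReal.ofReal_ne_top).2 hγl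
    rwa [ENNReal.toReal_ofReal hℓ.le] at this
  have hv1' : 0 ≤ v 1 := ENNReal.toReal_nonneg
  have hivt : ∀ t : ℝ, ∃ τ ∈ Icc (0:ℝ) 1, t ∈ Icc (0:ℝ) 1 → v τ = t * v 1 := by
    intro t
    by_cases ht : t ∈ Icc (0:ℝ) 1
    · obtain ⟨τ, hτ, h⟩ := intermediate_value_Icc zero_le_one hvc
        (show t * v 1 ∈ Icc (v 0) (v 1) by
          rw [hv0]; exact ⟨mul_nonneg ht.1 hv1', mul_le_of_le_one_left hv1' ht.2⟩)
      exact ⟨τ, hτ, fun _ => h⟩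
    · exact ⟨0, h0, fun h => absurd h ht⟩
  choose τ hτ hτv using hivt
  refine ⟨fun t => γ (τ t), fun t ht => ⟨hγU _ (hτ t), ?_, ?_, fun s hs => ?_⟩⟩
  · refine (smoothPathInf_subpath_le hγ (hτ t).1 fun u hu => hγU u (hsub h0 (hτ t) hu)).trans ?_
    rw [hv h0 (hτ t) (hτ t).1, hv0, hτv t ht]
    exact ENNReal.ofReal_le_ofReal (by nlinarith [ht.1])
  · refine (smoothPathInf_subpath_le hγ (hτ t).2 fun u hu => hγU u (hsub (hτ t) h1 hu)).trans ?_
    rw [hv (hτ t) h1 (hτ t).2, hτv t ht]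
    exact ENNReal.ofReal_le_ofReal (by nlinarith [ht.2])
  · have e : dist (γ (τ s)) (γ (τ t)) ≤ |v (τ s) - v (τ t)| := by
      rcases le_total (τ s) (τ t) with hst | hst
      · rw [abs_sub_comm]; exact (hvl (hτ s) (hτ t) hst).2
      · rw [dist_comm]; exact (hvl (hτ t) (hτ s) hst).2
    refine e.trans ?_
    rw [hτv s hs, hτv t ht, ← sub_mul, abs_mul, abs_of_nonneg hv1']
    exact mul_le_mul_of_nonneg_left hv1.le (abs_nonneg _)

end Paths

theorem exists_hasDerivAt_of_dist_eq {E : Type*} [NormedAddCommGroup E] [NormedSpace ℝ E]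
    [StrictConvexSpace ℝ E] {κ : ℝ → E} {t δ L : ℝ} (hδ : 0 < δ)
    (h : ∀ s ∈ Icc (t - δ) (t + δ), ∀ u ∈ Icc (t - δ) (t + δ), dist (κ s) (κ u) = L * |s - u|) :
    ∃ v : E, ∀ᶠ u in 𝓝 t, HasDerivAt κ v u := by
  set x := κ (t - δ)
  set z := κ (t + δ)
  have hxz : dist x z = L * (2 * δ) := by
    rw [h _ (by constructor <;> linarith) _ (by constructor <;> linarith), abs_sub_comm,
      abs_of_nonneg] <;> ring_nf; linarith
  have hline : ∀ u ∈ Icc (t - δ) (t + δ),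
      κ u = AffineMap.lineMap x z ((u - (t - δ)) / (2 * δ)) := by
    intro u hu
    apply eq_lineMap_of_dist_eq_mul_of_dist_eq_mul
    · rw [h _ (by constructor <;> linarith) _ hu, hxz, abs_sub_comm, abs_of_nonneg]
      · field_simp
      · linarith [hu.1]
    · rw [h _ hu _ (by constructor <;> linarith), hxz, abs_sub_comm, abs_of_nonneg]
      · field_simp; ring
      · linarith [hu.2]
  refine ⟨(2 * δ)⁻¹ • (z - x), ?_⟩
  filter_upwards [Ioo_mem_nhds (show t - δ < t by linarith) (show t < t + δ by linarith)] with u hu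
  have h1 : HasDerivAt (fun u : ℝ => AffineMap.lineMap x z ((u - (t - δ)) / (2 * δ)))
      ((2 * δ)⁻¹ • (z - x)) u := by
    have h2 : HasDerivAt (fun u : ℝ => (u - (t - δ)) / (2 * δ)) ((2 * δ)⁻¹) u := by
      simpa using ((hasDerivAt_id u).sub_const (t - δ)).div_const (2 * δ)
    simpa [AffineMap.lineMap_apply] using ((h2.smul_const (z - x)).add_const x)
  exact h1.congr_of_eventuallyEq (by
    filter_upwards [Ioo_mem_nhds hu.1 hu.2] with w hw using hline w (Ioo_subset_Icc_self hw))

/-- A curve in a strictly convex space that is locally a dilation of its parameter interval is so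
globally. -/
theorem dist_eq_of_locally_dist_eq {E : Type*} [NormedAddCommGroup E] [NormedSpace ℝ E]
    [StrictConvexSpace ℝ E] {κ : ℝ → E} {L : ℝ}
    (h : ∀ t ∈ Ioo (0:ℝ) 1, ∃ δ > 0, ∀ s ∈ Icc (t - δ) (t + δ), ∀ u ∈ Icc (t - δ) (t + δ),
      dist (κ s) (κ u) = L * |s - u|) :
    ∀ s ∈ Ioo (0:ℝ) 1, ∀ t ∈ Ioo (0:ℝ) 1, dist (κ s) (κ t) = L * |s - t| := by
  have hd : ∀ t ∈ Ioo (0:ℝ) 1, ∃ v : E, ∀ᶠ u in 𝓝 t, HasDerivAt κ v u := fun t ht => by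
    obtain ⟨δ, hδ, hδ'⟩ := h t ht
    exact exists_hasDerivAt_of_dist_eq hδ hδ'
  have hdd : ∀ t ∈ Ioo (0:ℝ) 1, HasDerivAt (deriv κ) 0 t := fun t ht => by
    obtain ⟨v, hv⟩ := hd t ht
    exact (hasDerivAt_const t v).congr_of_eventuallyEq (hv.mono fun u hu => hu.deriv)
  have hdiff : ∀ t ∈ Ioo (0:ℝ) 1, DifferentiableAt ℝ κ t := fun t ht => by
    obtain ⟨v, hv⟩ := hd t ht
    exact hv.self_of_nhds.differentiableAt
  obtain ⟨v, hv⟩ := isOpen_Ioo.exists_is_const_of_deriv_eq_zero isPreconnected_Ioo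
    (fun t ht => (hdd t ht).differentiableAt.differentiableWithinAt)
    (fun t ht => (hdd t ht).deriv)
  have hκ : ∀ t ∈ Ioo (0:ℝ) 1, HasDerivAt (fun t => κ t - t • v) 0 t := fun t ht => by
    have := (hdiff t ht).hasDerivAt.fun_sub ((hasDerivAt_id t).smul_const v)
    rw [hv t ht, one_smul, sub_self] at this
    exact this
  obtain ⟨w, hw⟩ := isOpen_Ioo.exists_is_const_of_deriv_eq_zero isPreconnected_Ioo
    (fun t ht => (hκ t ht).differentiableAt.differentiableWithinAt)
    (fun t ht => (hκ t ht).deriv)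
  have hdist : ∀ s ∈ Ioo (0:ℝ) 1, ∀ t ∈ Ioo (0:ℝ) 1, dist (κ s) (κ t) = ‖v‖ * |s - t| := by
    intro s hs t ht
    have e : κ s - κ t = (s - t) • v := by
      rw [eq_add_of_sub_eq (hw s hs), eq_add_of_sub_eq (hw t ht), sub_smul]; abel
    rw [dist_eq_norm, e, norm_smul, Real.norm_eq_abs, mul_comm]
  have hvL : ‖v‖ = L := by
    have hm : (1/2 : ℝ) ∈ Ioo (0:ℝ) 1 := by norm_num
    obtain ⟨δ, hδ, hδ'⟩ := h _ hm
    set η := min δ (1/4)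
    have hη : 0 < η := lt_min hδ (by norm_num)
    have h1 := hδ' (1/2) (by constructor <;> linarith) (1/2 + η)
      (by constructor <;> linarith [min_le_left δ (1/4)])
    rw [hdist _ hm _ (by constructor <;> linarith [min_le_right δ (1/4)])] at h1
    refine mul_right_cancel₀ ?_ h1
    simp [hη.ne']
  exact hvL ▸ hdist

/-- Two boundary points at finite relative distance `L` are either at Euclidean distance `L`, or
some boundary point lies metrically between them. -/
theorem dist_eq_or_exists_between {n : ℕ} {V : Set (EuclideanSpace ℝ (Fin n))} (hV : IsOpen V)
    {x y : EuclideanSpace ℝ (Fin n)} {L : ℝ} (hL : 0 ≤ L)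
    (h : relDist V x y = ENNReal.ofReal L) :
    dist x y = L ∨ ∃ c ∈ frontier V, ∃ t ∈ Ioo (0:ℝ) 1, relDist V x c ≤ ENNReal.ofReal (t * L) ∧
      relDist V c y ≤ ENNReal.ofReal ((1 - t) * L) := by
  obtain ⟨u, v, hu, hv, huV, hvV, huv⟩ := exists_seq_of_relDist_eq h hL
  choose κ hκV hκu hκv hκd using fun k => exists_arclength_sampling (huv k)
  let l : Filter ℕ := (hyperfilter ℕ : Filter ℕ)
  have hl : l ≤ atTop := Nat.hyperfilter_le_atTop
  have : l.NeBot := (hyperfilter ℕ).neBot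
  have hu' := hu.mono_left hl
  have hv' := hv.mono_left hl
  have hlen : Tendsto (fun k : ℕ => L + 1 / ((k : ℝ) + 1)) l (𝓝 L) := by
    simpa using (tendsto_one_div_add_atTop_nhds_zero_nat.mono_left hl).const_add L
  have hlim : ∀ t : ℝ, ∃ c, t ∈ Icc (0:ℝ) 1 → Tendsto (fun k => κ k t) l (𝓝 c) := by
    intro t
    by_cases ht : t ∈ Icc (0:ℝ) 1
    · obtain ⟨R, hR⟩ := (Metric.isBounded_range_of_tendsto u hu).subset_closedBall x
      have hmem : ∀ k, κ k t ∈ closedBall x (R + (L + 1)) := by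
        intro k
        have h1 : dist (u k) x ≤ R := hR (mem_range_self k)
        have h2 := edist_le_smoothPathInf.trans (hκu k t ht)
        have h0 : (0:ℝ) < 1 / (k + 1) := Nat.one_div_pos_of_nat
        have h01 : 1 / ((k:ℝ) + 1) ≤ 1 := by
          rw [div_le_one (by positivity)]; linarith [(Nat.cast_nonneg k : (0:ℝ) ≤ k)]
        rw [edist_dist, ENNReal.ofReal_le_ofReal_iff (mul_nonneg ht.1 (by linarith))] at h2
        have h3 : t * (L + 1 / (k + 1)) ≤ L + 1 := by nlinarith [ht.1, ht.2]
        rw [mem_closedBall]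
        linarith [dist_triangle (κ k t) (u k) x, dist_comm (κ k t) (u k)]
      obtain ⟨c, -, hc⟩ := (isCompact_closedBall x (R + (L + 1))).ultrafilter_le_nhds
        ((hyperfilter ℕ).map fun k => κ k t)
        (le_principal_iff.2 (Filter.mem_map.2 (Filter.univ_mem' hmem)))
      exact ⟨c, fun _ => hc⟩
    · exact ⟨x, fun h => absurd h ht⟩
  choose c hc using hlim
  have hlip : ∀ s ∈ Icc (0:ℝ) 1, ∀ t ∈ Icc (0:ℝ) 1, dist (c s) (c t) ≤ |s - t| * L :=
    fun s hs t ht => le_of_tendsto_of_tendsto ((hc s hs).dist (hc t ht)) (hlen.const_mul _)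
      (Filter.Eventually.of_forall fun k => hκd k t ht s hs)
  have hcu : ∀ t ∈ Icc (0:ℝ) 1, dist x (c t) ≤ t * L := fun t ht =>
    le_of_tendsto_of_tendsto (hu'.dist (hc t ht)) (hlen.const_mul _)
      (Filter.Eventually.of_forall fun k => by
        have h2 := edist_le_smoothPathInf.trans (hκu k t ht)
        have h0 : (0:ℝ) < 1 / (k + 1) := Nat.one_div_pos_of_nat
        rwa [edist_dist, ENNReal.ofReal_le_ofReal_iff (mul_nonneg ht.1 (by linarith))] at h2)
  have hcv : ∀ t ∈ Icc (0:ℝ) 1, dist (c t) y ≤ (1 - t) * L := fun t ht =>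
    le_of_tendsto_of_tendsto ((hc t ht).dist hv') (hlen.const_mul _)
      (Filter.Eventually.of_forall fun k => by
        have h2 := edist_le_smoothPathInf.trans (hκv k t ht)
        have h0 : (0:ℝ) < 1 / (k + 1) := Nat.one_div_pos_of_nat
        rwa [edist_dist, ENNReal.ofReal_le_ofReal_iff
          (mul_nonneg (sub_nonneg.2 ht.2) (by linarith))] at h2)
  by_cases hall : ∀ t ∈ Ioo (0:ℝ) 1, c t ∈ V
  swap
  · push Not at hall
    obtain ⟨t, ht, htV⟩ := hall
    have ht' := Ioo_subset_Icc_self ht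
    refine Or.inr ⟨c t, ?_, t, ht, ?_, ?_⟩
    · rw [frontier, hV.interior_eq]
      exact ⟨mem_closure_of_tendsto (hc t ht') (Filter.Eventually.of_forall fun k => hκV k t ht'),
        htV⟩
    · exact relDist_le_of_tendsto hu' (hc t ht') (Filter.Eventually.of_forall huV)
        (Filter.Eventually.of_forall fun k => hκV k t ht')
        (Filter.Eventually.of_forall fun k => hκu k t ht')
        (ENNReal.tendsto_ofReal (hlen.const_mul _))
    · exact relDist_le_of_tendsto (hc t ht') hv'
        (Filter.Eventually.of_forall fun k => hκV k t ht') (Filter.Eventually.of_forall hvV)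
        (Filter.Eventually.of_forall fun k => hκv k t ht')
        (ENNReal.tendsto_ofReal (hlen.const_mul _))
  left
  have hloc : ∀ t ∈ Ioo (0:ℝ) 1, ∃ δ > 0, ∀ s ∈ Icc (t - δ) (t + δ), ∀ u ∈ Icc (t - δ) (t + δ),
      dist (c s) (c u) = L * |s - u| := by
    intro t ht
    obtain ⟨r, hr, hrV⟩ := Metric.isOpen_iff.1 hV _ (hall t ht)
    obtain ⟨δ, hδ, hδt, hδt', hδr⟩ : ∃ δ > 0, δ ≤ t ∧ δ ≤ 1 - t ∧ δ * L < r := by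
      refine ⟨min (min t (1 - t)) (r / (2 * (L + 1))), ?_, ?_, ?_, ?_⟩
      · have := ht.1; have := sub_pos.2 ht.2; positivity
      · exact (min_le_left _ _).trans (min_le_left _ _)
      · exact (min_le_left _ _).trans (min_le_right _ _)
      · have h1 := min_le_right (min t (1 - t)) (r / (2 * (L + 1)))
        calc _ ≤ r / (2 * (L + 1)) * L := by gcongr
          _ = r * (L / (2 * (L + 1))) := by ring
          _ < r * 1 := by
            gcongr
            rw [div_lt_one (by linarith)]; linarith
          _ = r := mul_one r
    have hI : ∀ s ∈ Icc (t - δ) (t + δ), s ∈ Icc (0:ℝ) 1 ∧ c s ∈ ball (c t) r := by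
      intro s hs
      have hs' : s ∈ Icc (0:ℝ) 1 := ⟨by linarith [hs.1], by linarith [hs.2]⟩
      refine ⟨hs', (hlip s hs' t (Ioo_subset_Icc_self ht)).trans_lt ?_⟩
      have : |s - t| ≤ δ := abs_le.2 ⟨by linarith [hs.1], by linarith [hs.2]⟩
      exact (mul_le_mul_of_nonneg_right this hL).trans_lt hδr
    have key : ∀ s ∈ Icc (t - δ) (t + δ), ∀ u ∈ Icc (t - δ) (t + δ), s ≤ u →
        (u - s) * L ≤ dist (c s) (c u) := by
      intro s hs u hu hsu
      obtain ⟨hs1, hs2⟩ := hI s hs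
      obtain ⟨hu1, hu2⟩ := hI u hu
      have h1 : relDist V x y ≤ ENNReal.ofReal (s * L + dist (c s) (c u) + (1 - u) * L) := by
        refine relDist_le_of_tendsto (C := fun k => ENNReal.ofReal (s * (L + 1 / (k + 1)) +
          dist (κ k s) (κ k u) + (1 - u) * (L + 1 / (k + 1)))) hu' hv'
          (Filter.Eventually.of_forall huV)
          (Filter.Eventually.of_forall hvV) ?_ (ENNReal.tendsto_ofReal
            (((hlen.const_mul _).add ((hc s hs1).dist (hc u hu1))).add (hlen.const_mul _)))
        filter_upwards [hc s hs1 (isOpen_ball.mem_nhds hs2), hc u hu1 (isOpen_ball.mem_nhds hu2)]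
          with k hk1 hk2
        have h0 : (0:ℝ) < 1 / (k + 1) := Nat.one_div_pos_of_nat
        have hs0 : 0 ≤ s * (L + 1 / (k + 1)) := mul_nonneg hs1.1 (by linarith)
        have hu0 : 0 ≤ (1 - u) * (L + 1 / (k + 1)) :=
          mul_nonneg (sub_nonneg.2 hu1.2) (by linarith)
        rw [ENNReal.ofReal_add (by positivity) hu0, ENNReal.ofReal_add hs0 dist_nonneg,
          ← edist_dist]
        refine smoothPathInf_triangle.trans (add_le_add (smoothPathInf_triangle.trans
          (add_le_add (hκu k s hs1) ?_)) (hκv k u hu1))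
        exact smoothPathInf_le_of_segment_subset
          (((convex_ball (c t) r).segment_subset hk1 hk2).trans hrV)
      rw [h, ENNReal.ofReal_le_ofReal_iff] at h1
      · linarith
      · have := mul_nonneg hs1.1 hL
        have := mul_nonneg (sub_nonneg.2 hu1.2) hL
        positivity
    refine ⟨δ, hδ, fun s hs u hu => le_antisymm ?_ ?_⟩
    · rw [mul_comm]; exact hlip s (hI s hs).1 u (hI u hu).1
    · rcases le_total s u with hsu | hsu
      · rw [abs_sub_comm, abs_of_nonneg (sub_nonneg.2 hsu), mul_comm]; exact key s hs u hu hsu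
      · rw [abs_of_nonneg (sub_nonneg.2 hsu), mul_comm, dist_comm]; exact key u hu s hs hsu
  have hglob := dist_eq_of_locally_dist_eq hloc
  have hle : dist x y ≤ L := by
    have h0 : (1/2:ℝ) ∈ Icc (0:ℝ) 1 := by norm_num
    linarith [dist_triangle x (c (1/2)) y, hcu _ h0, hcv _ h0]
  refine le_antisymm hle (le_of_forall_pos_le_add fun ε hε => ?_)
  obtain ⟨τ, hτ, hτ2, hτε⟩ : ∃ τ > 0, τ < (1/2 : ℝ) ∧ τ * (4 * L) ≤ ε := by
    refine ⟨min (1/4) (ε / (4 * L + 1)), by positivity,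
      (min_le_left _ _).trans_lt (by norm_num), ?_⟩
    calc _ ≤ ε / (4 * L + 1) * (4 * L) := by gcongr; exact min_le_right _ _
      _ ≤ ε := by
        rw [div_mul_eq_mul_div, div_le_iff₀ (by linarith)]; nlinarith
  have h1 : τ ∈ Ioo (0:ℝ) 1 := ⟨hτ, by linarith⟩
  have h2 : 1 - τ ∈ Ioo (0:ℝ) 1 := ⟨by linarith, by linarith⟩
  have h3 := hglob τ h1 _ h2
  rw [abs_sub_comm, abs_of_nonneg (by linarith)] at h3
  have h4 := hcu τ (Ioo_subset_Icc_self h1)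
  have h5 := hcv _ (Ioo_subset_Icc_self h2)
  have h6 := dist_triangle (c τ) x (c (1 - τ))
  have h7 := dist_triangle x y (c (1 - τ))
  rw [dist_comm (c τ) x] at h6
  rw [dist_comm y] at h7
  nlinarith

local notation "𝔼" => EuclideanSpace ℝ (Fin 3)

/-- The region above the hyperbolic paraboloid `z = x * y`. -/
def saddleRegion : Set 𝔼 := {v | v 0 * v 1 < v 2}

/-- The parametrization of the hyperbolic paraboloid `z = x * y` by the horizontal plane. -/
def saddlePoint (w : ℂ) : 𝔼 := !₂[w.re, w.im, w.re * w.im]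

@[simp] theorem saddlePoint_zero (w : ℂ) : saddlePoint w 0 = w.re := rfl

@[simp] theorem saddlePoint_one (w : ℂ) : saddlePoint w 1 = w.im := rfl

@[simp] theorem saddlePoint_two (w : ℂ) : saddlePoint w 2 = w.re * w.im := rfl

theorem saddlePoint_injective : Function.Injective saddlePoint := fun _ _ h =>
  Complex.ext (congrArg (fun x : 𝔼 => x 0) h) (congrArg (fun x : 𝔼 => x 1) h)

theorem contDiff_saddlePoint : ContDiff ℝ 1 saddlePoint := by
  rw [contDiff_euclidean]
  have h1 : ContDiff ℝ 1 fun w : ℂ => w.re := Complex.reCLM.contDiff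
  have h2 : ContDiff ℝ 1 fun w : ℂ => w.im := Complex.imCLM.contDiff
  intro i
  fin_cases i
  · exact h1
  · exact h2
  · exact h1.mul h2

theorem isOpen_saddleRegion : IsOpen saddleRegion :=
  isOpen_lt (by fun_prop) (by fun_prop)

theorem frontier_saddleRegion : frontier saddleRegion = {v | v 0 * v 1 = v 2} := by
  refine (frontier_lt_subset_eq (by fun_prop) (by fun_prop)).antisymm fun v hv => ?_
  change v ∈ frontier saddleRegion
  rw [frontier, isOpen_saddleRegion.interior_eq]
  refine ⟨?_, fun h => h.ne hv⟩
  have ht : Tendsto (fun δ : ℝ => v + δ • EuclideanSpace.single 2 1) (𝓝[>] 0) (𝓝 v) := by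
    have : ContinuousAt (fun δ : ℝ => v + δ • (EuclideanSpace.single 2 1 : 𝔼)) 0 := by fun_prop
    simpa [ContinuousAt] using this.tendsto.mono_left nhdsWithin_le_nhds
  refine mem_closure_of_tendsto ht ?_
  filter_upwards [self_mem_nhdsWithin] with δ hδ
  have : v 0 * v 1 = v 2 := hv
  simpa [saddleRegion, this] using hδ

theorem range_saddlePoint : range saddlePoint = frontier saddleRegion := by
  rw [frontier_saddleRegion]
  refine Subset.antisymm (range_subset_iff.2 fun w => rfl) fun v (hv : v 0 * v 1 = v 2) => ?_
  refine ⟨⟨v 0, v 1⟩, ?_⟩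
  ext i
  fin_cases i
  · rfl
  · rfl
  · exact hv

theorem saddlePoint_mem_frontier (w : ℂ) : saddlePoint w ∈ frontier saddleRegion :=
  range_saddlePoint ▸ mem_range_self w

/-- The shear taking the paraboloid `z = x * y` to the plane `z = 0`. -/
def saddleShear (c : ℝ) (v : 𝔼) : 𝔼 := !₂[v 0, v 1, v 2 + c * (v 0 * v 1)]

theorem contDiff_saddleShear (c : ℝ) : ContDiff ℝ 1 (saddleShear c) := by
  rw [contDiff_euclidean]
  have h : ∀ i, ContDiff ℝ 1 fun v : 𝔼 => v i := contDiff_euclidean.1 contDiff_id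
  intro i
  fin_cases i
  · exact h 0
  · exact h 1
  · exact (h 2).add (contDiff_const.mul ((h 0).mul (h 1)))

theorem saddleShear_neg_saddleShear (c : ℝ) (v : 𝔼) : saddleShear (-c) (saddleShear c v) = v := by
  ext i
  fin_cases i
  · rfl
  · rfl
  · simp [saddleShear]

theorem saddleShear_image_halfSpace : saddleShear 1 '' {v : 𝔼 | 0 < v 2} = saddleRegion := by
  ext v
  constructor
  · rintro ⟨u, hu, rfl⟩
    simpa [saddleShear, saddleRegion] using hu
  · intro hv
    refine ⟨saddleShear (-1) v, ?_, by simpa using saddleShear_neg_saddleShear (-1) v⟩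
    simpa [saddleShear, saddleRegion] using hv

theorem isDomainSet_saddleRegion : IsDomainSet saddleRegion := by
  refine ⟨isOpen_saddleRegion, saddleShear_image_halfSpace ▸ IsConnected.image ?_ _
    (contDiff_saddleShear 1).continuous.continuousOn⟩
  refine Convex.isConnected ?_ ⟨EuclideanSpace.single 2 1, by simp⟩
  exact convex_halfSpace_gt (f := fun v : 𝔼 => v 2) ⟨fun _ _ => rfl, fun _ _ => rfl⟩ 0

theorem hasC1Boundary_saddleRegion : HasC1Boundary saddleRegion := by
  intro x _
  refine ⟨univ, univ, saddleShear (-1), saddleShear 1, EuclideanSpace.proj 2, isOpen_univ,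
    mem_univ _, isOpen_univ, fun h => ?_, (contDiff_saddleShear _).contDiffOn,
    (contDiff_saddleShear _).contDiffOn, mapsTo_univ _ _, mapsTo_univ _ _, fun z _ => ?_,
    fun z _ => saddleShear_neg_saddleShear 1 z, ?_⟩
  · simpa using congrArg (fun ℓ : 𝔼 →L[ℝ] ℝ => ℓ (EuclideanSpace.single 2 1)) h
  · simpa using saddleShear_neg_saddleShear (-1) z
  · rw [univ_inter, univ_inter, frontier_saddleRegion]
    ext v
    constructor
    · rintro ⟨u, hu, rfl⟩
      have : u 0 * u 1 = u 2 := hu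
      simp [saddleShear, this]
    · intro (hv : v 2 = 0)
      refine ⟨saddleShear 1 v, ?_, saddleShear_neg_saddleShear 1 v⟩
      simp [saddleShear, hv]

theorem not_convex_saddleRegion : ¬ Convex ℝ saddleRegion := by
  intro h
  have h1 : (!₂[1, -1, -1/2] : 𝔼) ∈ saddleRegion := by
    simp [saddleRegion]; norm_num
  have h2 : (!₂[-1, 1, -1/2] : 𝔼) ∈ saddleRegion := by
    simp [saddleRegion]; norm_num
  have h3 := h h1 h2 (a := 1/2) (b := 1/2) (by norm_num) (by norm_num) (by norm_num)
  simp [saddleRegion] at h3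
  norm_num at h3

/-- A path running weakly above the paraboloid bounds the relative distance of its end points. -/
theorem relDist_saddleRegion_le {γ : ℝ → 𝔼} (hγ : ContDiff ℝ 1 γ)
    (h : ∀ t ∈ Icc (0:ℝ) 1, γ t 0 * γ t 1 ≤ γ t 2) :
    relDist saddleRegion (γ 0) (γ 1) ≤ eVariationOn γ (Icc 0 1) := by
  let e : 𝔼 := EuclideanSpace.single 2 1
  have ht : ∀ v : 𝔼, Tendsto (fun δ : ℝ => v + δ • e) (𝓝[>] 0) (𝓝 v) := fun v => by
    have : ContinuousAt (fun δ : ℝ => v + δ • e) 0 := by fun_prop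
    simpa [ContinuousAt] using this.tendsto.mono_left nhdsWithin_le_nhds
  have hU : ∀ δ : ℝ, 0 < δ → ∀ t ∈ Icc (0:ℝ) 1, γ t + δ • e ∈ saddleRegion := fun δ hδ t ht' => by
    have := h t ht'
    simp [saddleRegion, e]
    linarith
  refine relDist_le_of_tendsto (C := fun _ => eVariationOn γ (Icc 0 1)) (ht (γ 0)) (ht (γ 1))
    ?_ ?_ ?_ tendsto_const_nhds
  · filter_upwards [self_mem_nhdsWithin] with δ hδ using hU δ hδ 0 (by simp)
  · filter_upwards [self_mem_nhdsWithin] with δ hδ using hU δ hδ 1 (by simp)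
  · filter_upwards [self_mem_nhdsWithin] with δ hδ
    refine (smoothPathInf_le (γ := fun t => γ t + δ • e) (hγ.add contDiff_const) rfl rfl
      (hU δ hδ)).trans (le_of_eq ?_)
    simp only [eVariationOn, edist_add_right]

theorem lineMap_saddlePoint_height (u v : ℂ) (t : ℝ) :
    AffineMap.lineMap (saddlePoint u) (saddlePoint v) t 2 -
      AffineMap.lineMap (saddlePoint u) (saddlePoint v) t 0 *
      AffineMap.lineMap (saddlePoint u) (saddlePoint v) t 1 =
    t * (1 - t) * ((u.re - v.re) * (u.im - v.im)) := by
  simp [AffineMap.lineMap_apply_module]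
  ring

theorem relDist_saddlePoint_of_visible {u v : ℂ} (h : 0 < (u.re - v.re) * (u.im - v.im)) :
    relDist saddleRegion (saddlePoint u) (saddlePoint v) =
      ENNReal.ofReal (dist (saddlePoint u) (saddlePoint v)) := by
  rw [← edist_dist]
  refine le_antisymm ?_ edist_le_relDist
  have hl : ContDiff ℝ 1 fun t : ℝ => AffineMap.lineMap (saddlePoint u) (saddlePoint v) t := by
    simp only [AffineMap.lineMap_apply_module]
    fun_prop
  have h1 := relDist_saddleRegion_le hl fun t ht => by
    have := lineMap_saddlePoint_height u v t
    have := mul_nonneg (mul_nonneg ht.1 (sub_nonneg.2 ht.2)) h.le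
    linarith
  simp only [AffineMap.lineMap_apply_zero, AffineMap.lineMap_apply_one] at h1
  refine h1.trans ((eVariationOn_Icc_le_of_dist_le (K := dist (saddlePoint u) (saddlePoint v))
    dist_nonneg zero_le_one fun s _ t _ => ?_).trans ?_)
  · rw [dist_lineMap_lineMap, Real.dist_eq, mul_comm]
  · simp [edist_dist]

theorem exists_relDist_saddlePoint_le (w : ℂ) : ∃ K : ℝ, 0 ≤ K ∧ ∃ r > 0, ∀ u ∈ ball w r,
    ∀ v ∈ ball w r, relDist saddleRegion (saddlePoint u) (saddlePoint v) ≤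
      ENNReal.ofReal (K * dist u v) := by
  obtain ⟨K, s, hs, hK⟩ := contDiff_saddlePoint.contDiffAt (x := w) |>.exists_lipschitzOnWith
  obtain ⟨r, hr, hrs⟩ := Metric.mem_nhds_iff.1 hs
  refine ⟨K, K.2, r, hr, fun u hu v hv => ?_⟩
  have hl' : ContDiff ℝ 1 fun t : ℝ => AffineMap.lineMap u v t := by
    simp only [AffineMap.lineMap_apply_module]
    fun_prop
  have hl : ContDiff ℝ 1 fun t : ℝ => saddlePoint (AffineMap.lineMap u v t) :=
    contDiff_saddlePoint.comp hl'
  have h1 := relDist_saddleRegion_le hl fun t ht => le_rfl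
  simp only [AffineMap.lineMap_apply_zero, AffineMap.lineMap_apply_one] at h1
  refine h1.trans ((eVariationOn_Icc_le_of_dist_le (K := K * dist u v)
    (mul_nonneg K.2 dist_nonneg) zero_le_one fun a ha b hb => ?_).trans (by simp))
  have hm : ∀ t ∈ Icc (0:ℝ) 1, AffineMap.lineMap u v t ∈ s := fun t ht =>
    hrs ((convex_ball w r).lineMap_mem hu hv ht)
  refine (hK.dist_le_mul _ (hm a ha) _ (hm b hb)).trans (le_of_eq ?_)
  rw [dist_lineMap_lineMap, Real.dist_eq]
  ring

section LocalIsometry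

variable {V : Set 𝔼} {f : 𝔼 → 𝔼}

theorem IsBoundaryLocalIsometry.exists_relDist_eq (hf : IsBoundaryLocalIsometry saddleRegion V f)
    (w : ℂ) : ∃ r > 0, ∀ u ∈ ball w r, ∀ v ∈ ball w r,
      relDist saddleRegion (saddlePoint u) (saddlePoint v) =
        relDist V (f (saddlePoint u)) (f (saddlePoint v)) := by
  obtain ⟨ε, hε, h⟩ := hf.2 _ (saddlePoint_mem_frontier w)
  obtain ⟨K, hK, r, hr, hKr⟩ := exists_relDist_saddlePoint_le w
  have ht : Tendsto (fun u => ENNReal.ofReal (K * dist u w)) (𝓝 w) (𝓝 0) := by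
    have : Continuous fun u : ℂ => ENNReal.ofReal (K * dist u w) :=
      ENNReal.continuous_ofReal.comp (by fun_prop)
    simpa using this.tendsto w
  obtain ⟨s, hs, hsε⟩ := Metric.eventually_nhds_iff_ball.1 (ht.eventually_lt_const hε)
  have hm : ∀ u ∈ ball w (min r s), relDist saddleRegion (saddlePoint u) (saddlePoint w) < ε :=
    fun u hu => (hKr u (ball_subset_ball (min_le_left _ _) hu) w (mem_ball_self hr)).trans_lt
      (hsε u (ball_subset_ball (min_le_right _ _) hu))
  exact ⟨min r s, lt_min hr hs, fun u hu v hv => h _ (saddlePoint_mem_frontier u) _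
    (saddlePoint_mem_frontier v) (hm u hu) (hm v hv)⟩

theorem IsBoundaryLocalIsometry.continuous_comp_saddlePoint
    (hf : IsBoundaryLocalIsometry saddleRegion V f) : Continuous fun w => f (saddlePoint w) := by
  refine continuous_iff_continuousAt.2 fun w => ?_
  obtain ⟨r, hr, h⟩ := hf.exists_relDist_eq w
  obtain ⟨K, hK, s, hs, hKs⟩ := exists_relDist_saddlePoint_le w
  rw [ContinuousAt, tendsto_iff_dist_tendsto_zero]
  have ht : Tendsto (fun u => K * dist u w) (𝓝 w) (𝓝 0) := by
    have : Continuous fun u : ℂ => K * dist u w := by fun_prop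
    simpa using this.tendsto w
  refine squeeze_zero' (Filter.Eventually.of_forall fun _ => dist_nonneg) ?_ ht
  filter_upwards [ball_mem_nhds w hr, ball_mem_nhds w hs] with u hu hu'
  have := (edist_le_relDist.trans (h u hu w (mem_ball_self hr)).ge).trans
    (hKs u hu' w (mem_ball_self hs))
  rwa [edist_dist, ENNReal.ofReal_le_ofReal_iff (mul_nonneg hK dist_nonneg)] at this

theorem IsBoundaryLocalIsometry.injective_comp_saddlePoint
    (hf : IsBoundaryLocalIsometry saddleRegion V f) :
    Function.Injective fun w => f (saddlePoint w) := fun u v h =>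
  saddlePoint_injective (hf.1.injOn (saddlePoint_mem_frontier u) (saddlePoint_mem_frontier v) h)

theorem IsBoundaryLocalIsometry.range_comp_saddlePoint
    (hf : IsBoundaryLocalIsometry saddleRegion V f) :
    range (fun w => f (saddlePoint w)) = frontier V := by
  rw [← hf.1.image_eq, ← range_saddlePoint, ← range_comp]
  rfl

/-- A continuous injective parametrization of a smooth boundary by the plane is an open map. -/
theorem HasC1Boundary.eventually_mem_image_ball (hV : HasC1Boundary V) {G : ℂ → 𝔼}
    (hG : Continuous G) (hinj : Function.Injective G) (hrange : range G = frontier V) (w : ℂ)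
    {r : ℝ} (hr : 0 < r) : ∀ᶠ c in 𝓝 (G w), c ∈ frontier V → ∃ u ∈ ball w r, G u = c := by
  obtain ⟨W, W', φ, ψ, ℓ, hW, hwW, -, hℓ, hφ, -, -, -, hψφ, -, hker⟩ :=
    hV (G w) (hrange ▸ mem_range_self w)
  have hφk : ∀ c ∈ W, c ∈ frontier V → φ c ∈ ℓ.ker := fun c hc hcV =>
    (hker ▸ mem_image_of_mem φ ⟨hc, hcV⟩ : φ c ∈ W' ∩ {y | ℓ y = 0}).2
  have hfin : Module.finrank ℝ ℓ.ker = Module.finrank ℝ ℂ := by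
    have h1 := LinearMap.finrank_range_add_finrank_ker (ℓ : 𝔼 →ₗ[ℝ] ℝ)
    have h2 : (ℓ : 𝔼 →ₗ[ℝ] ℝ).range = ⊤ := LinearMap.range_eq_top.2
      (LinearMap.surjective fun h => hℓ (ContinuousLinearMap.coe_injective h))
    rw [h2, finrank_top, Module.finrank_self, finrank_euclideanSpace_fin] at h1
    rw [Complex.finrank_real_complex]
    change Module.finrank ℝ (ℓ : 𝔼 →ₗ[ℝ] ℝ).ker = 2
    omega
  let e : ℓ.ker ≃L[ℝ] ℂ := ContinuousLinearEquiv.ofFinrankEq hfin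
  let g : 𝔼 → ℂ := fun c => e (ℓ.ker.orthogonalProjectionOnto (φ c))
  have hgc : ContinuousOn g W := by
    have : Continuous fun y : 𝔼 => e (ℓ.ker.orthogonalProjectionOnto y) := by fun_prop
    exact this.comp_continuousOn hφ.continuousOn
  have hgi : InjOn g (W ∩ frontier V) := by
    rintro a ⟨ha, haV⟩ b ⟨hb, hbV⟩ hab
    have h1 := e.injective hab
    have h2 := ℓ.ker.orthogonalProjectionOnto_mem_subspace_eq_self ⟨φ a, hφk a ha haV⟩
    have h3 := ℓ.ker.orthogonalProjectionOnto_mem_subspace_eq_self ⟨φ b, hφk b hb hbV⟩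
    rw [← hψφ a ha, ← hψφ b hb]
    exact congrArg ψ (congrArg Subtype.val ((h2.symm.trans h1).trans h3))
  obtain ⟨s, hs, hsW⟩ := Metric.mem_nhds_iff.1 (hG.continuousAt.preimage_mem_nhds (hW.mem_nhds hwW))
  set δ := min r s / 2
  have hmin : 0 < min r s := lt_min hr hs
  have hδ : 0 < δ := half_pos hmin
  have hδr : closedBall w δ ⊆ ball w r :=
    closedBall_subset_ball ((half_lt_self hmin).trans_le (min_le_left _ _))
  have hδW : MapsTo G (closedBall w δ) W := fun u hu =>
    hsW (closedBall_subset_ball ((half_lt_self hmin).trans_le (min_le_right _ _)) hu)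
  have hGV : ∀ u, G u ∈ frontier V := fun u => hrange ▸ mem_range_self u
  have hopen := image_closedBall_mem_nhds hδ (hgc.comp hG.continuousOn hδW)
    fun u hu v hv huv => hinj (hgi ⟨hδW hu, hGV u⟩ ⟨hδW hv, hGV v⟩ huv)
  filter_upwards [(hgc.continuousAt (hW.mem_nhds hwW)).preimage_mem_nhds hopen, hW.mem_nhds hwW]
    with c hc hcW hcV
  obtain ⟨u, hu, huc⟩ := hc
  exact ⟨u, hδr hu, hgi ⟨hδW hu, hGV u⟩ ⟨hcW, hcV⟩ huc⟩

/-- A local isometry of boundaries preserves the Euclidean distance of mutually visible points. -/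
theorem IsBoundaryLocalIsometry.exists_dist_eq (hV : IsOpen V) (hV' : HasC1Boundary V)
    (hf : IsBoundaryLocalIsometry saddleRegion V f) (w : ℂ) :
    ∃ r > 0, ∀ u ∈ ball w r, ∀ v ∈ ball w r, 0 < (u.re - v.re) * (u.im - v.im) →
      dist (f (saddlePoint u)) (f (saddlePoint v)) = dist (saddlePoint u) (saddlePoint v) := by
  obtain ⟨r, hr, h⟩ := hf.exists_relDist_eq w
  have hG := hf.continuous_comp_saddlePoint
  obtain ⟨η, hη, hηr⟩ := Metric.eventually_nhds_iff_ball.1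
    (hV'.eventually_mem_image_ball hG hf.injective_comp_saddlePoint hf.range_comp_saddlePoint w hr)
  have hP : ∀ᶠ u in 𝓝 w, dist (saddlePoint u) (saddlePoint w) < η / 4 :=
    contDiff_saddlePoint.continuous.continuousAt.eventually (ball_mem_nhds _ (by positivity))
  have hGη : ∀ᶠ u in 𝓝 w, dist (f (saddlePoint u)) (f (saddlePoint w)) < η / 2 :=
    hG.continuousAt.eventually (ball_mem_nhds _ (by positivity))
  obtain ⟨s, hs, hsη⟩ := Metric.eventually_nhds_iff_ball.1 (hP.and hGη)
  refine ⟨min r s, lt_min hr hs, fun u hu v hv huv => ?_⟩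
  have hur := ball_subset_ball (min_le_left r s) hu
  have hvr := ball_subset_ball (min_le_left r s) hv
  obtain ⟨hu1, hu2⟩ := hsη u (ball_subset_ball (min_le_right r s) hu)
  obtain ⟨hv1, -⟩ := hsη v (ball_subset_ball (min_le_right r s) hv)
  set L := dist (saddlePoint u) (saddlePoint v) with hL
  have hLη : L < η / 2 := by
    have := dist_triangle_right (saddlePoint u) (saddlePoint v) (saddlePoint w)
    linarith
  have hrel : relDist V (f (saddlePoint u)) (f (saddlePoint v)) = ENNReal.ofReal L := by
    rw [← h u hur v hvr, relDist_saddlePoint_of_visible huv]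
  refine (dist_eq_or_exists_between hV dist_nonneg hrel).resolve_right ?_
  rintro ⟨c, hc, t, ht, h1, h2⟩
  have hcη : dist c (f (saddlePoint w)) < η := by
    have h3 := edist_le_relDist.trans h1
    rw [edist_dist, ENNReal.ofReal_le_ofReal_iff (mul_nonneg ht.1.le dist_nonneg)] at h3
    have h4 := dist_triangle_left c (f (saddlePoint w)) (f (saddlePoint u))
    have h5 : t * L ≤ L := mul_le_of_le_one_left dist_nonneg ht.2.le
    linarith
  obtain ⟨m, hm, rfl⟩ := hηr c hcη hc
  rw [← h u hur m hm] at h1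
  rw [← h m hm v hvr] at h2
  replace h1 := edist_le_relDist.trans h1
  replace h2 := edist_le_relDist.trans h2
  rw [edist_dist, ENNReal.ofReal_le_ofReal_iff (mul_nonneg ht.1.le dist_nonneg)] at h1
  rw [edist_dist, ENNReal.ofReal_le_ofReal_iff
    (mul_nonneg (sub_nonneg.2 ht.2.le) dist_nonneg)] at h2
  have h3 := dist_triangle (saddlePoint u) (saddlePoint m) (saddlePoint v)
  have hline : saddlePoint m = AffineMap.lineMap (saddlePoint u) (saddlePoint v) t :=
    eq_lineMap_of_dist_eq_mul_of_dist_eq_mul (by linarith) (by linarith)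
  have h4 := lineMap_saddlePoint_height u v t
  rw [← hline] at h4
  simp only [saddlePoint_zero, saddlePoint_one, saddlePoint_two, sub_self] at h4
  exact (mul_pos (mul_pos ht.1 (sub_pos.2 ht.2)) huv).ne h4

end LocalIsometry

section Rigidity

variable {p q : Fin 4 → 𝔼}

theorem eq_of_dist_eq_of_spanning (hp : ∀ z : 𝔼, (∀ i : Fin 3, inner ℝ (p i.succ - p 0) z = 0) → z = 0)
    {x y : 𝔼} (h : ∀ i, dist x (p i) = dist y (p i)) : x = y := by
  refine sub_eq_zero.1 (hp _ fun i => ?_)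
  have key : ∀ i, ‖x‖ ^ 2 - 2 * inner ℝ x (p i) = ‖y‖ ^ 2 - 2 * inner ℝ y (p i) := fun i => by
    have h1 := congrArg (· ^ 2) (h i)
    simp only [dist_eq_norm, norm_sub_sq_real] at h1
    linarith
  have h1 := key 0
  have h2 := key i.succ
  simp only [inner_sub_left, inner_sub_right, real_inner_comm x, real_inner_comm y] at *
  linarith

theorem exists_isometryEquiv_of_dist_eq
    (hp : ∀ z : 𝔼, (∀ i : Fin 3, inner ℝ (p i.succ - p 0) z = 0) → z = 0)
    (h : ∀ i j, dist (q i) (q j) = dist (p i) (p j)) :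
    ∃ J : 𝔼 ≃ᵢ 𝔼, ∀ i, J (p i) = q i := by
  set a : Fin 3 → 𝔼 := fun i => p i.succ - p 0 with ha
  set b : Fin 3 → 𝔼 := fun i => q i.succ - q 0 with hb
  have hspan : ⊤ ≤ Submodule.span ℝ (range a) := by
    rw [top_le_iff, ← Submodule.orthogonal_eq_bot_iff, eq_bot_iff]
    exact fun z hz => hp z fun i =>
      (Submodule.mem_orthogonal _ z).1 hz _ (Submodule.subset_span (mem_range_self i))
  let B := basisOfTopLeSpanOfCardEqFinrank a hspan (by simp)
  have hB : ∀ i, B i = a i := fun i => by simp [B]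
  have hinner : ∀ i j, inner ℝ (b i) (b j) = inner ℝ (a i) (a j) := fun i j => by
    rw [real_inner_eq_norm_mul_self_add_norm_mul_self_sub_norm_sub_mul_self_div_two,
      real_inner_eq_norm_mul_self_add_norm_mul_self_sub_norm_sub_mul_self_div_two]
    simp only [ha, hb, sub_sub_sub_cancel_right, ← dist_eq_norm, h]
  let T : 𝔼 →ₗ[ℝ] 𝔼 := B.constr ℝ b
  have hT : ∀ i, T (a i) = b i := fun i => hB i ▸ B.constr_basis ℝ b i
  have hTi : ∀ x y, inner ℝ (T x) (T y) = inner ℝ x y := fun x y => by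
    rw [← B.sum_repr x, ← B.sum_repr y]
    simp only [map_sum, map_smul, sum_inner, inner_sum, inner_smul_left, inner_smul_right, hT,
      hinner, hB]
  let S := (T.isometryOfInner hTi).toLinearIsometryEquiv rfl
  have hS : ∀ i : Fin 3, S (p i.succ - p 0) = q i.succ - q 0 := hT
  refine ⟨(IsometryEquiv.subRight (p 0)).trans (S.toIsometryEquiv.trans
    (IsometryEquiv.addRight (q 0))), Fin.cases ?_ fun i => ?_⟩
  · simp
  · simp [hS]

end Rigidity

section SaddleRigidity

/-- Points on the lift of a planar parabola through `w` to the hyperbolic paraboloid; any two of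
them are mutually visible, and four of them are not coplanar. -/
def parabolaPoint (w : ℂ) (s : ℝ) : ℂ := w + ⟨s, s + s ^ 2⟩

theorem continuous_parabolaPoint (w : ℂ) : Continuous (parabolaPoint w) := by
  refine continuous_const.add (Complex.equivRealProdCLM.symm.continuous.comp
    (?_ : Continuous fun s : ℝ => (s, s + s ^ 2)))
  fun_prop

@[simp] theorem parabolaPoint_zero (w : ℂ) : parabolaPoint w 0 = w :=
  Complex.ext (by simp [parabolaPoint]) (by simp [parabolaPoint])

theorem parabolaPoint_visible (w : ℂ) {s t : ℝ} (hs : 0 ≤ s) (ht : 0 ≤ t) (hst : s ≠ t) :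
    0 < ((parabolaPoint w s).re - (parabolaPoint w t).re) *
      ((parabolaPoint w s).im - (parabolaPoint w t).im) := by
  have h1 : 0 < (s - t) ^ 2 := by
    have := sub_ne_zero.2 hst
    positivity
  have h2 : 0 < (s - t) ^ 2 * (1 + s + t) := by positivity
  simp only [parabolaPoint, Complex.add_re, Complex.add_im]
  nlinarith

/-- Four vertices of a tetrahedron inscribed in the hyperbolic paraboloid. -/
def saddleTetrahedron (w : ℂ) (δ : ℝ) (k : Fin 4) : ℂ := parabolaPoint w (((k : ℕ) + 1) * δ)

theorem saddleTetrahedron_visible (w : ℂ) {δ : ℝ} (hδ : 0 < δ) {i j : Fin 4} (hij : i ≠ j) :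
    0 < ((saddleTetrahedron w δ i).re - (saddleTetrahedron w δ j).re) *
      ((saddleTetrahedron w δ i).im - (saddleTetrahedron w δ j).im) := by
  refine parabolaPoint_visible w (by positivity) (by positivity) fun h => hij ?_
  have := mul_right_cancel₀ hδ.ne' h
  exact Fin.val_injective (Nat.cast_injective (add_right_cancel this))

theorem self_visible_saddleTetrahedron (w : ℂ) {δ : ℝ} (hδ : 0 < δ) (k : Fin 4) :
    0 < (w.re - (saddleTetrahedron w δ k).re) * (w.im - (saddleTetrahedron w δ k).im) := by
  have h : 0 < ((k : ℕ) + 1) * δ := by positivity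
  have := parabolaPoint_visible w le_rfl h.le h.ne
  rwa [parabolaPoint_zero] at this

theorem saddleTetrahedron_spanning (w : ℂ) {δ : ℝ} (hδ : δ ≠ 0) (z : 𝔼)
    (hz : ∀ i : Fin 3, inner ℝ (saddlePoint (saddleTetrahedron w δ i.succ) -
      saddlePoint (saddleTetrahedron w δ 0)) z = 0) : z = 0 := by
  have h0 := hz 0
  have h1 := hz 1
  have h2 := hz 2
  simp [PiLp.inner_apply, Fin.sum_univ_three, saddleTetrahedron, parabolaPoint, saddlePoint]
    at h0 h1 h2
  norm_num at h0 h1 h2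
  have e2 : z 2 = 0 := by
    have : δ ^ 3 * z 2 = 0 := by linear_combination (1/2) * h0 - (1/2) * h1 + (1/6) * h2
    simpa [hδ] using this
  have e1 : z 1 = 0 := by
    rw [e2] at h0 h1
    have : δ ^ 2 * z 1 = 0 := by linear_combination (1/2) * h1 - h0
    simpa [hδ] using this
  have e0 : z 0 = 0 := by
    rw [e2, e1] at h0
    have : δ * z 0 = 0 := by linear_combination h0
    simpa [hδ] using this
  ext i
  fin_cases i
  · exact e0
  · exact e1
  · exact e2

theorem exists_saddleTetrahedron_mem {w : ℂ} {s : Set ℂ} (hs : s ∈ 𝓝 w) :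
    ∃ δ > 0, ∀ k, saddleTetrahedron w δ k ∈ s := by
  have h : ∀ᶠ δ in 𝓝[>] (0:ℝ), ∀ k, saddleTetrahedron w δ k ∈ s := by
    refine eventually_all.2 fun k => nhdsWithin_le_nhds ?_
    have : Continuous fun δ => saddleTetrahedron w δ k :=
      (continuous_parabolaPoint w).comp (by fun_prop)
    refine this.continuousAt.preimage_mem_nhds ?_
    simpa [saddleTetrahedron] using hs
  obtain ⟨δ, h1, h2⟩ := (h.and self_mem_nhdsWithin).exists
  exact ⟨δ, h2, h1⟩

/-- An isometry of space is determined by its values near a point of the hyperbolic paraboloid. -/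
theorem isometryEquiv_eq_of_eventually_saddlePoint {J J' : 𝔼 ≃ᵢ 𝔼} {w : ℂ}
    (h : ∀ᶠ u in 𝓝 w, J (saddlePoint u) = J' (saddlePoint u)) : J = J' := by
  obtain ⟨δ, hδ, hm⟩ := exists_saddleTetrahedron_mem h
  ext1 x
  refine (J.symm.injective ?_)
  rw [J.symm_apply_apply]
  refine eq_of_dist_eq_of_spanning (p := fun k => saddlePoint (saddleTetrahedron w δ k))
    (saddleTetrahedron_spanning w hδ.ne') fun k => ?_
  have hk : J (saddlePoint (saddleTetrahedron w δ k)) = J' (saddlePoint (saddleTetrahedron w δ k)) :=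
    hm k
  rw [← J.dist_eq (J.symm (J' x)), J.apply_symm_apply, hk, J'.dist_eq]

variable {V : Set 𝔼} {f : 𝔼 → 𝔼}

theorem IsBoundaryLocalIsometry.exists_isometryEquiv_eventually (hV : IsOpen V)
    (hV' : HasC1Boundary V) (hf : IsBoundaryLocalIsometry saddleRegion V f) (w : ℂ) :
    ∃ J : 𝔼 ≃ᵢ 𝔼, ∀ᶠ u in 𝓝 w, f (saddlePoint u) = J (saddlePoint u) := by
  obtain ⟨r, hr, h⟩ := hf.exists_dist_eq hV hV' w
  obtain ⟨δ, hδ, hm⟩ := exists_saddleTetrahedron_mem (ball_mem_nhds w hr)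
  have hspan := saddleTetrahedron_spanning w hδ.ne'
  obtain ⟨J, hJ⟩ := exists_isometryEquiv_of_dist_eq
    (p := fun k => saddlePoint (saddleTetrahedron w δ k))
    (q := fun k => f (saddlePoint (saddleTetrahedron w δ k))) hspan fun i j => by
      rcases eq_or_ne i j with rfl | hij
      · simp
      · exact h _ (hm i) _ (hm j) (saddleTetrahedron_visible w hδ hij)
  refine ⟨J, ?_⟩
  have hvis : ∀ᶠ u in 𝓝 w, ∀ k, 0 < (u.re - (saddleTetrahedron w δ k).re) *
      (u.im - (saddleTetrahedron w δ k).im) := by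
    refine eventually_all.2 fun k => ?_
    have hc : Continuous fun u : ℂ => (u.re - (saddleTetrahedron w δ k).re) *
      (u.im - (saddleTetrahedron w δ k).im) := by fun_prop
    exact hc.continuousAt.eventually_const_lt (self_visible_saddleTetrahedron w hδ k)
  filter_upwards [hvis, ball_mem_nhds w hr] with u hu hur
  refine J.symm.injective ?_
  rw [J.symm_apply_apply]
  refine eq_of_dist_eq_of_spanning
    (p := fun k => saddlePoint (saddleTetrahedron w δ k)) hspan fun k => ?_
  have hk : J (saddlePoint (saddleTetrahedron w δ k)) =
    f (saddlePoint (saddleTetrahedron w δ k)) := hJ k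
  rw [← J.dist_eq, J.apply_symm_apply, hk]
  exact h u hur _ (hm k) (hu k)

theorem IsBoundaryLocalIsometry.exists_isometryEquiv (hV : IsOpen V)
    (hV' : HasC1Boundary V) (hf : IsBoundaryLocalIsometry saddleRegion V f) :
    ∃ J : 𝔼 ≃ᵢ 𝔼, ∀ u, f (saddlePoint u) = J (saddlePoint u) := by
  have hloc := hf.exists_isometryEquiv_eventually hV hV'
  obtain ⟨J, hJ⟩ := hloc 0
  let A : Set ℂ := {w | ∀ᶠ u in 𝓝 w, f (saddlePoint u) = J (saddlePoint u)}
  have hclosed : IsClosed A := by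
    refine isClosed_of_closure_subset fun w hw => ?_
    obtain ⟨J', hJ'⟩ := hloc w
    obtain ⟨w', hw', hw'A⟩ := mem_closure_iff_nhds.1 hw _ hJ'.eventually_nhds
    have hw'' : ∀ᶠ u in 𝓝 w', f (saddlePoint u) = J' (saddlePoint u) := hw'
    have hw3 : ∀ᶠ u in 𝓝 w', f (saddlePoint u) = J (saddlePoint u) := hw'A
    rwa [isometryEquiv_eq_of_eventually_saddlePoint (J := J') (J' := J)
      (hw''.mp (hw3.mono fun u h1 h2 => h2.symm.trans h1))] at hJ'
  have huniv := IsClopen.eq_univ ⟨hclosed, isOpen_setOfPred_eventually_nhds⟩ ⟨0, hJ⟩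
  refine ⟨J, fun u => ?_⟩
  have hu : ∀ᶠ u' in 𝓝 u, f (saddlePoint u') = J (saddlePoint u') :=
    (huniv ▸ mem_univ u : u ∈ A)
  exact hu.self_of_nhds

end SaddleRigidity

theorem IsPreconnected.subset_of_disjoint_frontier {X : Type*} [TopologicalSpace X] {s t : Set X}
    (hs : IsPreconnected s) (hst : (s ∩ t).Nonempty) (hd : Disjoint s (frontier t)) : s ⊆ t := by
  have hcover : s ⊆ interior t ∪ (closure t)ᶜ := fun x hx => by
    by_contra h
    simp only [mem_union, mem_compl_iff, not_or, not_not] at h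
    exact hd.le_bot ⟨hx, h.2, h.1⟩
  obtain ⟨x, hxs, hxt⟩ := hst
  refine (hs.subset_left_of_subset_union isOpen_interior isClosed_closure.isOpen_compl ?_ hcover
    ⟨x, hxs, (hcover hxs).resolve_right fun h => h (subset_closure hxt)⟩).trans interior_subset
  exact disjoint_left.2 fun y hy hy' => hy' (subset_closure (interior_subset hy))

theorem IsDomainSet.eq_of_frontier_eq {n : ℕ} {U V : Set (EuclideanSpace ℝ (Fin n))}
    (hU : IsDomainSet U) (hV : IsDomainSet V) (h : frontier U = frontier V)
    (hUV : (U ∩ V).Nonempty) : U = V := by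
  refine Subset.antisymm ?_ ?_
  · exact hU.2.isPreconnected.subset_of_disjoint_frontier hUV
      (h ▸ (disjoint_frontier_iff_isOpen.2 hU.1).symm)
  · exact hV.2.isPreconnected.subset_of_disjoint_frontier (inter_comm U V ▸ hUV)
      (h ▸ (disjoint_frontier_iff_isOpen.2 hV.1).symm)

theorem IsDomainSet.preimage_isometryEquiv {n : ℕ} {V : Set (EuclideanSpace ℝ (Fin n))}
    (hV : IsDomainSet V) (J : EuclideanSpace ℝ (Fin n) ≃ᵢ EuclideanSpace ℝ (Fin n)) :
    IsDomainSet (J ⁻¹' V) :=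
  ⟨hV.1.preimage J.continuous, J.toHomeomorph.isConnected_preimage.2 hV.2⟩

/-- The half-turn about the first coordinate axis, which exchanges the two sides of the hyperbolic
paraboloid. -/
def saddleFlip : 𝔼 ≃ᵢ 𝔼 :=
  IsometryEquiv.mk' (fun v => !₂[v 0, -v 1, -v 2]) (fun v => !₂[v 0, -v 1, -v 2])
    (fun v => by ext i; fin_cases i <;> simp)
    (Isometry.of_dist_eq fun u v => by
      simp [EuclideanSpace.dist_eq, Fin.sum_univ_three, dist_neg_neg])

theorem saddleFlip_apply (v : 𝔼) : saddleFlip v = !₂[v 0, -v 1, -v 2] := rfl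

theorem saddleFlip_preimage_frontier :
    saddleFlip ⁻¹' frontier saddleRegion = frontier saddleRegion := by
  rw [frontier_saddleRegion]
  ext v
  simp [saddleFlip_apply]

/-- Up to an isometry, the region above the hyperbolic paraboloid is the only domain bounded by
it. -/
theorem IsDomainSet.exists_image_saddleRegion_eq {V : Set 𝔼} (hV : IsDomainSet V)
    (h : frontier V = frontier saddleRegion) : ∃ J : 𝔼 ≃ᵢ 𝔼, J '' saddleRegion = V := by
  by_cases hne : (saddleRegion ∩ V).Nonempty
  · exact ⟨IsometryEquiv.refl _,
      (image_id _).trans (isDomainSet_saddleRegion.eq_of_frontier_eq hV h.symm hne)⟩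
  · have hf : frontier (saddleFlip ⁻¹' V) = frontier saddleRegion := by
      rw [← saddleFlip.coe_toHomeomorph, ← saddleFlip.toHomeomorph.preimage_frontier, h]
      exact saddleFlip_preimage_frontier
    obtain ⟨v, hv⟩ := hV.2.nonempty
    have hlt : v 2 < v 0 * v 1 := by
      refine lt_of_le_of_ne (not_lt.1 fun h' => hne ⟨v, h', hv⟩) fun h' => ?_
      have : v ∈ frontier V := by
        rw [h, frontier_saddleRegion]
        exact h'.symm
      exact (disjoint_frontier_iff_isOpen.2 hV.1).le_bot ⟨this, hv⟩
    have hv' : (saddleRegion ∩ saddleFlip ⁻¹' V).Nonempty := by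
      refine ⟨saddleFlip.symm v, ?_, by simpa using hv⟩
      change v 0 * -v 1 < -v 2
      linarith
    refine ⟨saddleFlip, ?_⟩
    rw [isDomainSet_saddleRegion.eq_of_frontier_eq (hV.preimage_isometryEquiv _) hf.symm hv',
      image_preimage_eq _ saddleFlip.surjective]

/-- there exists a nonconvex domain in `ℝ³` with smooth boundary
which is uniquely determined, in the class of all three-dimensional domains with
smooth boundaries, by the condition of local isometry of boundaries in the
relative metrics. -/
theorem exists_nonconvex_space_domain_uniquely_determined :
    ∃ U : Set (EuclideanSpace ℝ (Fin 3)), IsDomainSet U ∧ HasC1Boundary U ∧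
      ¬ Convex ℝ U ∧
      ∀ V : Set (EuclideanSpace ℝ (Fin 3)), IsDomainSet V → HasC1Boundary V →
        (∃ f : EuclideanSpace ℝ (Fin 3) → EuclideanSpace ℝ (Fin 3),
          IsBoundaryLocalIsometry U V f) →
        ∃ J : EuclideanSpace ℝ (Fin 3) ≃ᵢ EuclideanSpace ℝ (Fin 3), J '' U = V := by
  refine ⟨saddleRegion, isDomainSet_saddleRegion, hasC1Boundary_saddleRegion,
    not_convex_saddleRegion, ?_⟩
  rintro V hV hV' ⟨f, hf⟩
  obtain ⟨J, hJ⟩ := hf.exists_isometryEquiv hV.1 hV'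
  have hfr : frontier (J ⁻¹' V) = frontier saddleRegion := by
    rw [← J.coe_toHomeomorph, ← J.toHomeomorph.preimage_frontier, ← hf.range_comp_saddlePoint,
      ← range_saddlePoint]
    simp_rw [hJ]
    rw [show (fun w => J (saddlePoint w)) = J ∘ saddlePoint from rfl, range_comp]
    exact J.injective.preimage_image _
  obtain ⟨K, hK⟩ := (hV.preimage_isometryEquiv J).exists_image_saddleRegion_eq hfr
  refine ⟨K.trans J, ?_⟩
  rw [show ⇑(K.trans J) = J ∘ K from rfl, image_comp, hK, image_preimage_eq _ J.surjective]

end
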